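/- arXiv:1901.07793 — 3 statements merged into one kernel-verified Lean document; each statement's English description precedes it below -/
import Mathlib

section
/- Let K and Q be positive integers with Q ≤ K. For every integer u with K−Q+2 ≤ u ≤ K−1, the second difference of Z_K^Q has the closed form (Z_K^Q(u+1) − Z_K^Q(u)) − (Z_K^Q(u) − Z_K^Q(u−1)) = ∑_{l=u+Q−K}^{min(u,Q−1)} 2·C(u−1,l−1)·C(K−u−1,Q−l−1) / ((l−1)·l·(l+1)), as an identity of rational numbers. -/
/-- The rational sequence `Z_K^Q(u)` from the paper:
`Z_K^Q(u) = ∑_{l=u+Q−K}^{min(u,Q)} ((Q−l)/(Q·l))·C(u,l)·C(K−u,Q−l)`. -/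
def Z (K Q u : ℕ) : ℚ :=
  ∑ l ∈ Finset.Icc (u + Q - K) (min u Q),
    (((Q : ℚ) - (l : ℚ)) / ((Q : ℚ) * (l : ℚ))) * (u.choose l : ℚ) *
      ((K - u).choose (Q - l) : ℚ)

open Finset in
/-- The Vandermonde sum `∑_{i+j=n} C(a,i)·C(b,j)` weighted by `f i`. -/
def weightedVandermonde (f : ℕ → ℚ) (a b n : ℕ) : ℚ :=
  ∑ p ∈ antidiagonal n, f p.1 * (a.choose p.1 : ℚ) * (b.choose p.2 : ℚ)

theorem weightedVandermonde_succ_left (f : ℕ → ℚ) (a b n : ℕ) :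
    weightedVandermonde f (a + 1) b (n + 1) =
      weightedVandermonde f a b (n + 1) + weightedVandermonde (fun i => f (i + 1)) a b n := by
  simp only [weightedVandermonde, Finset.Nat.sum_antidiagonal_succ, Nat.choose_zero_right,
    add_assoc, ← Finset.sum_add_distrib]
  congr 1
  refine Finset.sum_congr rfl fun p _ => ?_
  rw [Nat.choose_succ_succ']
  push_cast
  ring

theorem weightedVandermonde_succ_right (f : ℕ → ℚ) (a b n : ℕ) :
    weightedVandermonde f a (b + 1) (n + 1) =
      weightedVandermonde f a b (n + 1) + weightedVandermonde f a b n := by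
  simp only [weightedVandermonde, Finset.Nat.sum_antidiagonal_succ', Nat.choose_zero_right,
    add_assoc, ← Finset.sum_add_distrib]
  congr 1
  refine Finset.sum_congr rfl fun p _ => ?_
  rw [Nat.choose_succ_succ']
  push_cast
  ring

/-- The second difference of a weighted Vandermonde sum along `a + b = const` is the weighted
Vandermonde sum of the second difference of the weight. -/
theorem weightedVandermonde_second_difference (f : ℕ → ℚ) (a b n : ℕ) :
    weightedVandermonde f (a + 2) b (n + 2) - 2 * weightedVandermonde f (a + 1) (b + 1) (n + 2) +
        weightedVandermonde f a (b + 2) (n + 2) =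
      weightedVandermonde (fun i => f (i + 2) - 2 * f (i + 1) + f i) a b n := by
  have h : weightedVandermonde (fun i => f (i + 2) - 2 * f (i + 1) + f i) a b n =
      weightedVandermonde (fun i => f (i + 2)) a b n -
        2 * weightedVandermonde (fun i => f (i + 1)) a b n + weightedVandermonde f a b n := by
    simp only [weightedVandermonde, Finset.mul_sum, ← Finset.sum_add_distrib,
      ← Finset.sum_sub_distrib]
    exact Finset.sum_congr rfl fun p _ => by ring
  simp only [h, weightedVandermonde_succ_left, weightedVandermonde_succ_right]
  ring

/-- The nonzero terms of a weighted Vandermonde sum have index in `[n - b, min a n]`. -/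
theorem weightedVandermonde_eq_sum_Icc (f : ℕ → ℚ) (a b n : ℕ) :
    weightedVandermonde f a b n =
      ∑ l ∈ Finset.Icc (n - b) (min a n), f l * (a.choose l : ℚ) * (b.choose (n - l) : ℚ) := by
  rw [weightedVandermonde, Finset.Nat.sum_antidiagonal_eq_sum_range_succ
    (fun i j => f i * (a.choose i : ℚ) * (b.choose j : ℚ))]
  symm
  apply Finset.sum_subset
  · intro l hl
    simp only [Finset.mem_Icc, Finset.mem_range] at hl ⊢
    omega
  · intro l hl hl'
    simp only [Finset.mem_Icc, Finset.mem_range] at hl hl'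
    rcases lt_or_ge a l with h | h
    · simp [Nat.choose_eq_zero_of_lt h]
    · have h : b < n - l := by omega
      simp [Nat.choose_eq_zero_of_lt h]

theorem Z_eq_weightedVandermonde {K Q u v : ℕ} (h : u + v = K) :
    Z K Q u = weightedVandermonde (fun l => ((Q : ℚ) - l) / (Q * l)) u v Q := by
  subst h
  rw [weightedVandermonde_eq_sum_Icc, Z, Nat.add_sub_add_left, Nat.add_sub_cancel_left]

/-- closed form of the second difference of `Z_K^Q`:
for `K−Q+2 ≤ u ≤ K−1`,
`(Z_K^Q(u+1) − Z_K^Q(u)) − (Z_K^Q(u) − Z_K^Q(u−1))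
  = ∑_{l=u+Q−K}^{min(u,Q−1)} 2·C(u−1,l−1)·C(K−u−1,Q−l−1)/((l−1)·l·(l+1))`. -/
theorem Z_second_difference (K Q : ℕ) (hK : 0 < K) (hQ : 0 < Q) (hQK : Q ≤ K)
    (u : ℕ) (hu1 : K - Q + 2 ≤ u) (hu2 : u ≤ K - 1) :
    (Z K Q (u + 1) - Z K Q u) - (Z K Q u - Z K Q (u - 1)) =
      ∑ l ∈ Finset.Icc (u + Q - K) (min u (Q - 1)),
        2 * ((u - 1).choose (l - 1) : ℚ) * ((K - u - 1).choose (Q - l - 1) : ℚ) /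
          (((l : ℚ) - 1) * (l : ℚ) * ((l : ℚ) + 1)) := by
  obtain ⟨a, rfl⟩ : ∃ a, u = a + 1 := ⟨u - 1, by omega⟩
  obtain ⟨b, rfl⟩ : ∃ b, K = a + b + 2 := ⟨K - a - 2, by omega⟩
  obtain ⟨n, rfl⟩ : ∃ n, Q = n + 2 := ⟨Q - 2, by omega⟩
  rw [Z_eq_weightedVandermonde (K := a + b + 2) (u := a + 1 + 1) (v := b) (by ring),
    Z_eq_weightedVandermonde (K := a + b + 2) (u := a + 1) (v := b + 1) (by ring),
    Z_eq_weightedVandermonde (K := a + b + 2) (u := a + 1 - 1) (v := b + 2)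
      (by rw [Nat.add_sub_cancel]; ring),
    Nat.add_sub_cancel, show ∀ x y z : ℚ, x - y - (y - z) = x - 2 * y + z by intros; ring,
    weightedVandermonde_second_difference, weightedVandermonde_eq_sum_Icc]
  have hlo : a + 1 + (n + 2) - (a + b + 2) = n - b + 1 := by omega
  have hhi : min (a + 1) (n + 2 - 1) = min a n + 1 := by omega
  rw [hlo, hhi, ← Finset.map_add_right_Icc, Finset.sum_map]
  refine Finset.sum_congr rfl fun l hl => ?_
  rw [Finset.mem_Icc] at hl
  have hl0 : (l : ℚ) ≠ 0 := Nat.cast_ne_zero.2 (by omega)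
  have hl1 : (l : ℚ) + 1 ≠ 0 := by positivity
  have hl2 : (l : ℚ) + 2 ≠ 0 := by positivity
  have hn : (n : ℚ) + 2 ≠ 0 := by positivity
  have hb : a + b + 2 - (a + 1) - 1 = b := by omega
  have hnl : n + 2 - (l + 1) - 1 = n - l := by omega
  rw [addRightEmbedding_apply, hb, hnl, Nat.add_sub_cancel]
  push_cast
  rw [add_sub_cancel_right, add_assoc (l : ℚ) 1 1, one_add_one_eq_two]
  field_simp
  ring
end

section
/- Let K and Q be integers with 1 ≤ Q ≤ K. For every integer u with 2 ≤ u ≤ K−1, the first difference of U_K^Q has the closed form U_K^Q(u+1) − U_K^Q(u) = − ∑_{l=max(2, u−K+Q)}^{min(u,Q−1)} C(u−1,l−1)·C(K−u−1,Q−l−1) / (l·(l−1)), as an identity of rational numbers. -/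
/-- The rational sequence `U_K^Q(u)` from the paper:
`U_K^Q(u) = C(K−u, Q−1) + ∑_{l=max(1, u−K+Q−1)}^{min(u,Q)−1} (1/l)·C(u−1,l)·C(K−u,Q−l−1)`. -/
def U (K Q u : ℕ) : ℚ :=
  ((K - u).choose (Q - 1) : ℚ) +
    ∑ l ∈ Finset.Icc (max 1 (u + Q - K - 1)) (min u Q - 1),
      (1 / (l : ℚ)) * ((u - 1).choose l : ℚ) * ((K - u).choose (Q - l - 1) : ℚ)

/-- `U` with the summation range freed of the cutoffs beyond which the binomials vanish. -/
lemma U_eq_sum_range (q m n : ℕ) :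
    U (m + 1 + n) (q + 1) (m + 1) = (n.choose q : ℚ) +
      ∑ i ∈ Finset.range q, (m.choose (i + 1) : ℚ) * (n.choose (q - (i + 1)) : ℚ) / (i + 1) := by
  have hn : m + 1 + n - (m + 1) = n := by omega
  have hsum : ∑ i ∈ Finset.range q,
      (m.choose (i + 1) : ℚ) * (n.choose (q - (i + 1)) : ℚ) / (i + 1) =
      ∑ l ∈ Finset.Ico 1 (q + 1),
        (1 / (l : ℚ)) * (m.choose l : ℚ) * (n.choose (q + 1 - l - 1) : ℚ) := by
    rw [Finset.sum_Ico_eq_sum_range]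
    refine Finset.sum_congr rfl fun i _ => ?_
    rw [show q + 1 - (1 + i) - 1 = q - (i + 1) by omega, add_comm 1 i]
    push_cast
    ring
  rw [U, hn, hsum]
  simp only [Nat.add_sub_cancel]
  congr 1
  refine Finset.sum_subset (fun l hl => ?_) fun l hl hl' => ?_
  · simp only [Finset.mem_Icc, Finset.mem_Ico] at hl ⊢
    omega
  · simp only [Finset.mem_Icc, Finset.mem_Ico] at hl hl'
    have h : m < l ∨ n < q + 1 - l - 1 := by omega
    rcases h with h | h <;> simp [Nat.choose_eq_zero_of_lt h]

/-- The closed form of the first difference, with the summation range freed of the cutoffs beyond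
which the binomials vanish. -/
lemma sum_Icc_choose_div_eq_sum_range (r m n : ℕ) :
    ∑ l ∈ Finset.Icc (max 2 (m + 1 + (r + 2) - (m + 1 + (n + 1)))) (min (m + 1) (r + 1)),
        (m.choose (l - 1) : ℚ) * (n.choose (r + 2 - l - 1) : ℚ) / ((l : ℚ) * ((l : ℚ) - 1)) =
      ∑ i ∈ Finset.range r,
        (m.choose (i + 1) : ℚ) * (n.choose (r - (i + 1)) : ℚ) / ((i + 2) * (i + 1)) := by
  have hsum : ∑ i ∈ Finset.range r,
      (m.choose (i + 1) : ℚ) * (n.choose (r - (i + 1)) : ℚ) / ((i + 2) * (i + 1)) =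
      ∑ l ∈ Finset.Ico 2 (r + 2),
        (m.choose (l - 1) : ℚ) * (n.choose (r + 2 - l - 1) : ℚ) / ((l : ℚ) * ((l : ℚ) - 1)) := by
    rw [Finset.sum_Ico_eq_sum_range, Nat.add_sub_cancel]
    refine Finset.sum_congr rfl fun i _ => ?_
    rw [show r + 2 - (2 + i) - 1 = r - (i + 1) by omega, show 2 + i - 1 = i + 1 by omega]
    push_cast
    congr 1
    ring
  rw [hsum]
  refine Finset.sum_subset (fun l hl => ?_) fun l hl hl' => ?_
  · simp only [Finset.mem_Icc, Finset.mem_Ico] at hl ⊢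
    omega
  · simp only [Finset.mem_Icc, Finset.mem_Ico] at hl hl'
    have h : m < l - 1 ∨ n < r + 2 - l - 1 := by omega
    rcases h with h | h <;> simp [Nat.choose_eq_zero_of_lt h]

/-- The first difference of the sums of `U_eq_sum_range`. -/
lemma choose_add_sum_range_sub (r m n : ℕ) :
    ((n.choose (r + 1) : ℚ) + ∑ i ∈ Finset.range (r + 1),
        ((m + 1).choose (i + 1) : ℚ) * (n.choose (r + 1 - (i + 1)) : ℚ) / (i + 1)) -
      (((n + 1).choose (r + 1) : ℚ) + ∑ i ∈ Finset.range (r + 1),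
        (m.choose (i + 1) : ℚ) * ((n + 1).choose (r + 1 - (i + 1)) : ℚ) / (i + 1)) =
      -∑ i ∈ Finset.range r,
        (m.choose (i + 1) : ℚ) * (n.choose (r - (i + 1)) : ℚ) / ((i + 2) * (i + 1)) := by
  have hm : ∑ i ∈ Finset.range (r + 1),
      ((m + 1).choose (i + 1) : ℚ) * (n.choose (r + 1 - (i + 1)) : ℚ) / (i + 1) =
      (∑ i ∈ Finset.range r,
        (m.choose (i + 1) : ℚ) * (n.choose (r - (i + 1)) : ℚ) / (i + 2) + n.choose r) +
      (∑ i ∈ Finset.range r, (m.choose (i + 1) : ℚ) * (n.choose (r - i) : ℚ) / (i + 1) +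
        m.choose (r + 1) / (r + 1)) := by
    simp only [Nat.choose_succ_succ', Nat.cast_add, add_mul, add_div, Finset.sum_add_distrib,
      Nat.add_sub_add_right]
    rw [Finset.sum_range_succ', Finset.sum_range_succ _ r]
    simp [add_assoc, one_add_one_eq_two]
  have hn : ∑ i ∈ Finset.range (r + 1),
      (m.choose (i + 1) : ℚ) * ((n + 1).choose (r + 1 - (i + 1)) : ℚ) / (i + 1) =
      ∑ i ∈ Finset.range r, (m.choose (i + 1) : ℚ) * (n.choose (r - (i + 1)) : ℚ) / (i + 1) +
      ∑ i ∈ Finset.range r, (m.choose (i + 1) : ℚ) * (n.choose (r - i) : ℚ) / (i + 1) +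
        m.choose (r + 1) / (r + 1) := by
    rw [Finset.sum_range_succ, ← Finset.sum_add_distrib]
    congr 1
    · refine Finset.sum_congr rfl fun i hi => ?_
      have hi : i < r := Finset.mem_range.mp hi
      rw [show r + 1 - (i + 1) = r - (i + 1) + 1 by omega, Nat.choose_succ_succ',
        show r - (i + 1) + 1 = r - i by omega]
      push_cast
      ring
    · simp
  have hdiv : ∑ i ∈ Finset.range r,
        (m.choose (i + 1) : ℚ) * (n.choose (r - (i + 1)) : ℚ) / ((i + 2) * (i + 1)) =
      ∑ i ∈ Finset.range r, (m.choose (i + 1) : ℚ) * (n.choose (r - (i + 1)) : ℚ) / (i + 1) -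
      ∑ i ∈ Finset.range r, (m.choose (i + 1) : ℚ) * (n.choose (r - (i + 1)) : ℚ) / (i + 2) := by
    rw [← Finset.sum_sub_distrib]
    refine Finset.sum_congr rfl fun i _ => ?_
    field_simp
    ring
  rw [hm, hn, hdiv, Nat.choose_succ_succ' n r]
  push_cast
  ring

/-- closed form of the first difference of `U_K^Q`:
for `1 ≤ Q ≤ K` and `2 ≤ u ≤ K−1`,
`U_K^Q(u+1) − U_K^Q(u)
  = − ∑_{l=max(2, u−K+Q)}^{min(u,Q−1)} C(u−1,l−1)·C(K−u−1,Q−l−1)/(l·(l−1))`. -/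
theorem U_first_difference (K Q : ℕ) (hQ1 : 1 ≤ Q) (hQK : Q ≤ K)
    (u : ℕ) (hu1 : 2 ≤ u) (hu2 : u ≤ K - 1) :
    U K Q (u + 1) - U K Q u =
      - ∑ l ∈ Finset.Icc (max 2 (u + Q - K)) (min u (Q - 1)),
          ((u - 1).choose (l - 1) : ℚ) * ((K - u - 1).choose (Q - l - 1) : ℚ) /
            ((l : ℚ) * ((l : ℚ) - 1)) := by
  obtain ⟨m, rfl⟩ : ∃ m, u = m + 1 := ⟨u - 1, by omega⟩
  obtain ⟨n, rfl⟩ : ∃ n, K = m + 1 + (n + 1) := ⟨K - (m + 1) - 1, by omega⟩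
  obtain ⟨q, rfl⟩ : ∃ q, Q = q + 1 := ⟨Q - 1, by omega⟩
  have hU : U (m + 1 + (n + 1)) (q + 1) (m + 1 + 1) = _ :=
    (congrArg (fun K => U K (q + 1) (m + 1 + 1)) (by omega)).trans (U_eq_sum_range q (m + 1) n)
  rw [hU, U_eq_sum_range, show m + 1 + (n + 1) - (m + 1) - 1 = n by omega]
  cases q with
  | zero => simp
  | succ r =>
    rw [choose_add_sum_range_sub, ← sum_Icc_choose_div_eq_sum_range]
    rfl
end

section
/- Let K, Q, r, F, S be positive integers with 3 ≤ Q ≤ K and max(K−Q+1, 2) ≤ r ≤ K−1. Let A be an F×K placement delivery array with S ordinary symbols in which every row contains exactly r star entries. For each t ∈ {1,…,K}, let S_t be the number of ordinary symbols of A that occur exactly t times, and set θ_t = S_t·t / (F·(K−r)). If ∑_{t=1}^{K} θ_t · U_K^Q(t) = U_K^Q(r+1), then every ordinary symbol of A occurs exactly r+1 times (i.e., A is (r+1)-regular) and F ≥ C(K, r). -/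
/-- `A` is a placement delivery array (PDA): `A` is an `F × K` array whose entries are
either a star (`none`) or an ordinary symbol (`some s` with `s : Fin S`); every ordinary
symbol occurs at least once; and whenever two distinct entries carry the same ordinary
symbol `s`, they lie in distinct rows and columns and the two "opposite corner" entries
are stars. -/
def IsPDA {F K S : ℕ} (A : Fin F → Fin K → Option (Fin S)) : Prop :=
  (∀ s : Fin S, ∃ j k, A j k = some s) ∧
  ∀ (j₁ j₂ : Fin F) (k₁ k₂ : Fin K) (s : Fin S),
    A j₁ k₁ = some s → A j₂ k₂ = some s → (j₁, k₁) ≠ (j₂, k₂) →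
      j₁ ≠ j₂ ∧ k₁ ≠ k₂ ∧ A j₁ k₂ = none ∧ A j₂ k₁ = none

/-- Number of occurrences of the ordinary symbol `s` in the array `A`. -/
def occ {F K S : ℕ} (A : Fin F → Fin K → Option (Fin S)) (s : Fin S) : ℕ :=
  (Finset.univ.filter fun p : Fin F × Fin K => A p.1 p.2 = some s).card

open Finset

/-- The weight of a set meeting a fixed set in `l` points: `1` for `l = 0` and `1 / l` otherwise. -/
def reciprocalWeight (l : ℕ) : ℚ := if l = 0 then 1 else 1 / (l : ℚ)

lemma reciprocalWeight_succ_le (l : ℕ) : reciprocalWeight (l + 1) ≤ reciprocalWeight l := by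
  rcases l with _ | l
  · simp [reciprocalWeight]
  · simp only [reciprocalWeight, Nat.add_eq_zero_iff, one_ne_zero, and_false, if_false]
    apply one_div_le_one_div_of_le <;> push_cast <;> linarith [Nat.cast_nonneg (α := ℚ) l]

lemma reciprocalWeight_succ_lt {l : ℕ} (hl : 1 ≤ l) :
    reciprocalWeight (l + 1) < reciprocalWeight l := by
  have hpos : (0 : ℚ) < l := by exact_mod_cast hl
  simp only [reciprocalWeight, Nat.add_eq_zero_iff, one_ne_zero, and_false, if_false,
    Nat.one_le_iff_ne_zero.mp hl]
  apply one_div_lt_one_div_of_lt hpos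
  push_cast
  linarith

lemma U_eq_sum_range_s9 (a b n : ℕ) :
    U (a + b + 1) (n + 1) (a + 1) =
      ∑ l ∈ range (n + 1), reciprocalWeight l * (a.choose l : ℚ) * (b.choose (n - l) : ℚ) := by
  have hrange : range (n + 1) = insert 0 (Icc 1 n) := by
    ext l
    simp only [mem_range, mem_insert, mem_Icc]
    omega
  rw [hrange, sum_insert (by simp)]
  unfold U
  congr 1
  · simp [reciprocalWeight, show a + b + 1 - (a + 1) = b by omega]
  · rw [← sum_subset (s₁ := Icc (max 1 (a + 1 + (n + 1) - (a + b + 1) - 1))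
      (min (a + 1) (n + 1) - 1)) (s₂ := Icc 1 n)]
    · refine sum_congr rfl fun l hl => ?_
      rw [mem_Icc] at hl
      rw [reciprocalWeight, if_neg (by omega), show a + b + 1 - (a + 1) = b by omega,
        show n + 1 - l - 1 = n - l by omega, Nat.add_sub_cancel]
    · intro l hl
      rw [mem_Icc] at hl ⊢
      omega
    · intro l hl hl'
      rw [mem_Icc] at hl hl'
      rcases lt_or_ge a l with h | h
      · simp [Nat.choose_eq_zero_of_lt h]
      · simp [Nat.choose_eq_zero_of_lt (show b < n - l by omega)]

lemma sum_weighted_choose_sub (f : ℕ → ℚ) (a b m : ℕ) :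
    ∑ l ∈ range (m + 2), f l * (a.choose l : ℚ) * ((b + 1).choose (m + 1 - l) : ℚ) -
      ∑ l ∈ range (m + 2), f l * ((a + 1).choose l : ℚ) * (b.choose (m + 1 - l) : ℚ) =
    ∑ l ∈ range (m + 1), (f l - f (l + 1)) * (a.choose l : ℚ) * (b.choose (m - l) : ℚ) := by
  have h1 : ∑ l ∈ range (m + 2), f l * (a.choose l : ℚ) * ((b + 1).choose (m + 1 - l) : ℚ) =
      ∑ l ∈ range (m + 2), f l * (a.choose l : ℚ) * (b.choose (m + 1 - l) : ℚ) +
      ∑ l ∈ range (m + 1), f l * (a.choose l : ℚ) * (b.choose (m - l) : ℚ) := by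
    rw [sum_range_succ, sum_range_succ (n := m + 1), add_right_comm, ← sum_add_distrib]
    congr 1
    · refine sum_congr rfl fun l hl => ?_
      rw [mem_range] at hl
      rw [show m + 1 - l = m - l + 1 by omega, Nat.choose_succ_succ]
      push_cast
      ring
    · simp
  have h2 : ∑ l ∈ range (m + 2), f l * ((a + 1).choose l : ℚ) * (b.choose (m + 1 - l) : ℚ) =
      ∑ l ∈ range (m + 2), f l * (a.choose l : ℚ) * (b.choose (m + 1 - l) : ℚ) +
      ∑ l ∈ range (m + 1), f (l + 1) * (a.choose l : ℚ) * (b.choose (m - l) : ℚ) := by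
    rw [sum_range_succ', sum_range_succ' (n := m + 1), add_right_comm, ← sum_add_distrib]
    congr 1
    · refine sum_congr rfl fun l hl => ?_
      rw [Nat.add_sub_add_right, Nat.choose_succ_succ]
      push_cast
      ring
    · simp
  rw [h1, h2, add_sub_add_left_eq_sub, ← sum_sub_distrib]
  refine sum_congr rfl fun l _ => ?_
  ring

lemma U_sub_U_succ (a b m : ℕ) :
    U (a + b + 2) (m + 2) (a + 1) - U (a + b + 2) (m + 2) (a + 2) =
      ∑ l ∈ range (m + 1), (reciprocalWeight l - reciprocalWeight (l + 1)) *
        (a.choose l : ℚ) * (b.choose (m - l) : ℚ) := by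
  have h1 := U_eq_sum_range_s9 a (b + 1) (m + 1)
  have h2 := U_eq_sum_range_s9 (a + 1) b (m + 1)
  rw [show a + 1 + b + 1 = a + b + 2 by ring] at h2
  rw [show a + (b + 1) + 1 = a + b + 2 by ring] at h1
  rw [h1, h2, sum_weighted_choose_sub]

lemma weighted_choose_nonneg (a b m l : ℕ) :
    0 ≤ (reciprocalWeight l - reciprocalWeight (l + 1)) *
      (a.choose l : ℚ) * (b.choose (m - l) : ℚ) := by
  have := sub_nonneg.mpr (reciprocalWeight_succ_le l)
  positivity

lemma U_succ_le {K Q u : ℕ} (hQ : 2 ≤ Q) (hu : 1 ≤ u) (huK : u < K) :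
    U K Q (u + 1) ≤ U K Q u := by
  obtain ⟨a, rfl⟩ := Nat.exists_eq_add_of_le' hu
  obtain ⟨m, rfl⟩ := Nat.exists_eq_add_of_le' hQ
  obtain ⟨b, rfl⟩ : ∃ b, K = a + b + 2 := ⟨K - a - 2, by omega⟩
  rw [← sub_nonneg, U_sub_U_succ]
  exact sum_nonneg fun l _ => weighted_choose_nonneg a b m l

lemma U_succ_lt {K Q u : ℕ} (hQ : 3 ≤ Q) (hQK : Q ≤ K) (hu : 2 ≤ u) (huK : u < K) :
    U K Q (u + 1) < U K Q u := by
  obtain ⟨a, rfl⟩ := Nat.exists_eq_add_of_le' (show 1 ≤ u by omega)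
  obtain ⟨m, rfl⟩ := Nat.exists_eq_add_of_le' (show 2 ≤ Q by omega)
  obtain ⟨b, rfl⟩ : ∃ b, K = a + b + 2 := ⟨K - a - 2, by omega⟩
  rw [← sub_pos, U_sub_U_succ]
  refine sum_pos' (fun l _ => weighted_choose_nonneg a b m l)
    ⟨min a m, mem_range.mpr (by omega), ?_⟩
  have h1 := sub_pos.mpr (reciprocalWeight_succ_lt (show 1 ≤ min a m by omega))
  have h2 : 0 < a.choose (min a m) := Nat.choose_pos (by omega)
  have h3 : 0 < b.choose (m - min a m) := Nat.choose_pos (by omega)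
  positivity

lemma U_lt_of_le {K Q r t : ℕ} (hQ : 3 ≤ Q) (hQK : Q ≤ K) (hr : 2 ≤ r) (hrK : r < K)
    (ht : 1 ≤ t) (htr : t ≤ r) : U K Q (r + 1) < U K Q t := by
  refine (U_succ_lt hQ hQK hr hrK).trans_le ?_
  induction r, htr using Nat.le_induction with
  | base => exact le_rfl
  | succ n hn ih =>
    refine (U_succ_le (by omega) (by omega) (by omega)).trans ?_
    rcases lt_or_ge n 2 with h | h
    · obtain rfl : t = n := by omega
      exact le_rfl
    · exact ih h (by omega)

section

variable {F K S : ℕ} {A : Fin F → Fin K → Option (Fin S)}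

/-- The columns in which row `j` has a star. -/
def starSet (A : Fin F → Fin K → Option (Fin S)) (j : Fin F) : Finset (Fin K) :=
  univ.filter fun k => A j k = none

/-- The columns in which the symbol `s` occurs. -/
def symbolColumns (A : Fin F → Fin K → Option (Fin S)) (s : Fin S) : Finset (Fin K) :=
  (univ.filter fun p : Fin F × Fin K => A p.1 p.2 = some s).image Prod.snd

lemma mem_symbolColumns {s : Fin S} {k : Fin K} :
    k ∈ symbolColumns A s ↔ ∃ j, A j k = some s := by
  simp [symbolColumns]

lemma IsPDA.card_symbolColumns (hA : IsPDA A) (s : Fin S) :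
    (symbolColumns A s).card = occ A s := by
  refine card_image_of_injOn fun p hp q hq hpq => ?_
  simp only [coe_filter, mem_univ, true_and, Set.mem_ofPred_eq] at hp hq
  by_contra hne
  exact (hA.2 _ _ _ _ s hp hq hne).2.1 hpq

lemma IsPDA.symbolColumns_subset (hA : IsPDA A) {s : Fin S} {j : Fin F} {k : Fin K}
    (h : A j k = some s) : symbolColumns A s ⊆ insert k (starSet A j) := by
  intro k' hk'
  obtain ⟨j', hj'⟩ := mem_symbolColumns.mp hk'
  rw [mem_insert]
  by_cases hk : k' = k
  · exact Or.inl hk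
  · refine Or.inr (mem_filter.mpr ⟨mem_univ _, (hA.2 j j' k k' s h hj' ?_).2.2.1⟩)
    exact fun e => hk (Prod.ext_iff.mp e).2.symm

lemma card_insert_starSet {s : Fin S} {j : Fin F} {k : Fin K} (h : A j k = some s) :
    (insert k (starSet A j)).card = (starSet A j).card + 1 :=
  card_insert_of_notMem (by simp [starSet, h])

lemma IsPDA.occ_pos (hA : IsPDA A) (s : Fin S) : 0 < occ A s := by
  obtain ⟨j, k, h⟩ := hA.1 s
  exact card_pos.mpr ⟨(j, k), by simpa using h⟩

lemma IsPDA.occ_le (hA : IsPDA A) {r : ℕ} (hrow : ∀ j, (starSet A j).card = r) (s : Fin S) :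
    occ A s ≤ r + 1 := by
  obtain ⟨j, k, h⟩ := hA.1 s
  rw [← hA.card_symbolColumns, ← hrow j, ← card_insert_starSet h]
  exact card_le_card (hA.symbolColumns_subset h)

lemma IsPDA.symbolColumns_eq (hA : IsPDA A) {r : ℕ} (hrow : ∀ j, (starSet A j).card = r)
    {s : Fin S} (hs : occ A s = r + 1) {j : Fin F} {k : Fin K} (h : A j k = some s) :
    symbolColumns A s = insert k (starSet A j) :=
  eq_of_subset_of_card_le (hA.symbolColumns_subset h)
    (by rw [hA.card_symbolColumns, hs, card_insert_starSet h, hrow])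

/-- In a regular array the star sets are closed under exchanging one element. -/
lemma IsPDA.exists_starSet_exchange (hA : IsPDA A) {r : ℕ}
    (hrow : ∀ j, (starSet A j).card = r) (hreg : ∀ s, occ A s = r + 1)
    (j : Fin F) {k k' : Fin K} (hk : k ∉ starSet A j) (hk' : k' ∈ starSet A j) :
    ∃ j', starSet A j' = (insert k (starSet A j)).erase k' := by
  obtain ⟨s, hs⟩ := Option.ne_none_iff_exists'.mp
    (show A j k ≠ none by simpa [starSet] using hk)
  have hcols := hA.symbolColumns_eq hrow (hreg s) hs
  obtain ⟨j', hj'⟩ := mem_symbolColumns.mp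
    (show k' ∈ symbolColumns A s by rw [hcols]; exact mem_insert_of_mem hk')
  refine ⟨j', ?_⟩
  rw [← hcols, hA.symbolColumns_eq hrow (hreg s) hj', erase_insert]
  simp [starSet, hj']

lemma IsPDA.exists_starSet_eq (hA : IsPDA A) {r : ℕ} (hF : 0 < F)
    (hrow : ∀ j, (starSet A j).card = r) (hreg : ∀ s, occ A s = r + 1)
    (R : Finset (Fin K)) (hR : R.card = r) : ∃ j, starSet A j = R := by
  suffices H : ∀ n, ∀ j : Fin F, (R \ starSet A j).card = n → ∃ j', starSet A j' = R from
    H _ ⟨0, hF⟩ rfl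
  intro n
  induction n with
  | zero =>
    intro j hj
    rw [card_eq_zero, sdiff_eq_empty_iff_subset] at hj
    exact ⟨j, (eq_of_subset_of_card_le hj (by rw [hrow, hR])).symm⟩
  | succ n ih =>
    intro j hj
    have hcard : (starSet A j \ R).card = n + 1 := by
      rw [← hj]
      exact card_sdiff_comm (by rw [hrow, hR])
    obtain ⟨k, hk⟩ := card_pos.mp (show 0 < (R \ starSet A j).card by omega)
    obtain ⟨k', hk'⟩ := card_pos.mp (show 0 < (starSet A j \ R).card by omega)
    have hk2 := mem_sdiff.mp hk
    have hk2' := mem_sdiff.mp hk'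
    obtain ⟨j', hj'⟩ := hA.exists_starSet_exchange hrow hreg j hk2.2 hk2'.1
    refine ih j' ?_
    have hsdiff : R \ starSet A j' = (R \ starSet A j).erase k := by
      ext x
      simp only [hj', mem_sdiff, mem_erase, mem_insert]
      grind
    rw [hsdiff, card_erase_of_mem hk, hj, Nat.add_sub_cancel]

lemma IsPDA.choose_le_of_regular (hA : IsPDA A) {r : ℕ} (hF : 0 < F)
    (hrow : ∀ j, (starSet A j).card = r) (hreg : ∀ s, occ A s = r + 1) :
    K.choose r ≤ F := by
  have hsub : powersetCard r (univ : Finset (Fin K)) ⊆ univ.image (starSet A) := by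
    intro R hR
    obtain ⟨j, hj⟩ := hA.exists_starSet_eq hF hrow hreg R (mem_powersetCard.mp hR).2
    exact mem_image.mpr ⟨j, mem_univ _, hj⟩
  simpa using (card_le_card hsub).trans card_image_le

lemma sum_occ_add {r : ℕ} (hrow : ∀ j, (starSet A j).card = r) :
    ∑ s, occ A s + F * r = F * K := by
  have hfib := card_eq_sum_card_fiberwise (s := (univ : Finset (Fin F × Fin K)))
    (t := (univ : Finset (Option (Fin S)))) (f := fun p => A p.1 p.2) (by simp)
  rw [Fintype.sum_option] at hfib
  have hnone : (univ.filter fun p : Fin F × Fin K => A p.1 p.2 = none).card = F * r := by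
    simp only [starSet, card_filter] at hrow
    rw [card_filter, Fintype.sum_prod_type]
    simp [hrow]
  simp only [card_univ, Fintype.card_prod, Fintype.card_fin] at hfib
  rw [hnone] at hfib
  rw [hfib, add_comm]
  rfl

lemma sum_card_occ_mul (hpos : ∀ s, 1 ≤ occ A s) (hle : ∀ s, occ A s ≤ K) (g : ℕ → ℚ) :
    ∑ t ∈ Icc 1 K, ((univ.filter fun s : Fin S => occ A s = t).card : ℚ) * g t =
      ∑ s, g (occ A s) := by
  rw [← sum_fiberwise_of_maps_to (s := univ) (t := Icc 1 K) (g := occ A)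
    (fun s _ => mem_Icc.mpr ⟨hpos s, hle s⟩)]
  refine sum_congr rfl fun t _ => ?_
  rw [sum_congr rfl fun s hs => by rw [(mem_filter.mp hs).2], sum_const, nsmul_eq_mul]

end

/-- let `K, Q, r, F, S` be positive integers with `3 ≤ Q ≤ K` and
`max(K−Q+1, 2) ≤ r ≤ K−1`.  Let `A` be an `F × K` PDA with `S` ordinary symbols in
which every row contains exactly `r` star entries.  For `t ∈ {1,…,K}`, let `S_t` be
the number of ordinary symbols occurring exactly `t` times, and `θ_t = S_t·t/(F·(K−r))`.
If `∑_{t=1}^{K} θ_t · U_K^Q(t) = U_K^Q(r+1)`, then every ordinary symbol of `A` occurs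
exactly `r+1` times and `F ≥ C(K, r)`. -/
theorem pda_optimal_implies_regular_and_file_bound (K Q r F S : ℕ)
    (hK : 0 < K) (hQpos : 0 < Q) (hrpos : 0 < r) (hF : 0 < F) (hS : 0 < S)
    (hQ3 : 3 ≤ Q) (hQK : Q ≤ K)
    (hr1 : max (K - Q + 1) 2 ≤ r) (hr2 : r ≤ K - 1)
    (A : Fin F → Fin K → Option (Fin S)) (hA : IsPDA A)
    (hrow : ∀ j : Fin F,
      (Finset.univ.filter fun k : Fin K => A j k = none).card = r)
    (hload : ∑ t ∈ Finset.Icc 1 K,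
        ((((Finset.univ.filter fun s : Fin S => occ A s = t).card : ℚ) * (t : ℚ)) /
            ((F : ℚ) * ((K : ℚ) - (r : ℚ)))) * U K Q t
      = U K Q (r + 1)) :
    (∀ s : Fin S, occ A s = r + 1) ∧ K.choose r ≤ F := by
  have hrK : r < K := by omega
  have hr : 2 ≤ r := (le_max_right _ _).trans hr1
  have hstar : ∀ j, (starSet A j).card = r := hrow
  have hle := hA.occ_le hstar
  have hload' : ∑ s, (occ A s : ℚ) * U K Q (occ A s) = F * ((K : ℚ) - r) * U K Q (r + 1) := by
    have hFpos : (0 : ℚ) < F := by exact_mod_cast hF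
    have hKr : (0 : ℚ) < (K : ℚ) - r := sub_pos.mpr (by exact_mod_cast hrK)
    rw [← hload, mul_sum, ← sum_card_occ_mul hA.occ_pos (fun s => (hle s).trans hrK)
      (fun t => (t : ℚ) * U K Q t)]
    refine sum_congr rfl fun t _ => ?_
    field_simp
  have hsum : ∑ s, (occ A s : ℚ) = F * ((K : ℚ) - r) := by
    have h := sum_occ_add hstar
    have h' : ∑ s, (occ A s : ℚ) + F * r = F * K := by exact_mod_cast h
    linarith
  have hzero : ∑ s, (occ A s : ℚ) * (U K Q (occ A s) - U K Q (r + 1)) = 0 := by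
    simp only [mul_sub, sum_sub_distrib]
    rw [← sum_mul, hload', hsum, sub_self]
  have hlt : ∀ s, occ A s ≠ r + 1 → 0 < U K Q (occ A s) - U K Q (r + 1) := fun s hs =>
    sub_pos.mpr (U_lt_of_le hQ3 hQK hr hrK (hA.occ_pos s)
      (Nat.lt_succ_iff.mp (lt_of_le_of_ne (hle s) hs)))
  have hreg : ∀ s, occ A s = r + 1 := by
    intro s
    by_contra hs
    have hterm := (sum_eq_zero_iff_of_nonneg fun s _ => ?_).mp hzero s (mem_univ s)
    · have hocc : (0 : ℚ) < occ A s := by exact_mod_cast hA.occ_pos s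
      exact (mul_pos hocc (hlt s hs)).ne' hterm
    · by_cases h : occ A s = r + 1
      · simp [h]
      · exact mul_nonneg (Nat.cast_nonneg _) (hlt s h).le
  exact ⟨hreg, hA.choose_le_of_regular hF hstar hreg⟩
end
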